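/- Soundness of the Box case of the grounding function: Let P : ℕ → Prop, let t_b ≤ t_e be natural numbers, and let [c_1,h_1], …, [c_m,h_m] (m ≥ 1) be intervals of natural numbers with c_i ≤ c_{i+1} and c_{i+1} ≤ h_i for all 1 ≤ i < m, c_1 ≤ t_b, t_e ≤ h_m, and c_i ≤ h_i for all i. If for each i, P t' holds for every t' with c_i ≤ t' ≤ h_i, then P t' holds for every t' with t_b ≤ t' ≤ t_e. -/

import Mathlib

/-- Soundness of the Box case of the grounding function: if `P` holds
throughout each annotation interval `[c i, h i]` of a consecutive,
overlapping chain subsuming `[t_b, t_e]`, then `P` holds throughout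
`[t_b, t_e]`. -/
theorem box_grounding_sound (P : ℕ → Prop) (m : ℕ) (hm : 1 ≤ m)
    (c h : ℕ → ℕ) (tb te : ℕ) (htbe : tb ≤ te)
    (hcons : ∀ i, i + 1 < m → c i ≤ c (i + 1))
    (hover : ∀ i, i + 1 < m → c (i + 1) ≤ h i)
    (hch : ∀ i, i < m → c i ≤ h i)
    (hfirst : c 0 ≤ tb) (hlast : te ≤ h (m - 1))
    (hP : ∀ i, i < m → ∀ t', c i ≤ t' → t' ≤ h i → P t') :
    ∀ t', tb ≤ t' → t' ≤ te → P t' := by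
  intro t h1 h2
  have key : ∀ k, k < m → t ≤ h k → P t := by
    intro k
    induction k with
    | zero => intro hk ht; exact hP 0 hk t (by omega) ht
    | succ k ih =>
      intro hk ht
      by_cases hc : c (k + 1) ≤ t
      · exact hP (k + 1) hk t hc ht
      · have := hover k hk
        exact ih (by omega) (by omega)
  exact key (m - 1) (by omega) (by omega)
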